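/- For every integer n ≥ 1, the subring of S_n-invariant elements of R_n is generated as a Q-algebra by the elements p_{r,s} for integers r, s ≥ 0 with 0 < r + s ≤ n together with the elements p̃_{r',s'} for integers r', s' ≥ 0 with 0 ≤ r' + s' < n. -/

import Mathlib

open scoped TensorProduct

set_option synthInstance.maxHeartbeats 1000000
set_option maxHeartbeats 1000000

noncomputable section

/-- The commutative polynomial ring `A_n = ℚ[x_1,…,x_n, y_1,…,y_n]`,
with variable `(i, 0)` playing the role of `x_i` and `(i, 1)` that of `y_i`. -/
abbrev An (n : ℕ) : Type := MvPolynomial (Fin n × Fin 2) ℚ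

/-- The Grassmann algebra `Λ(θ_1,…,θ_n)` over `ℚ`. -/
abbrev Ln (n : ℕ) : Type := ExteriorAlgebra ℚ (Fin n → ℚ)

/-- The ring `R_n = ℚ[x_1,…,x_n,y_1,…,y_n,θ_1,…,θ_n]`, realized as `A_n ⊗ Λ(θ)`. -/
abbrev Rn (n : ℕ) : Type := An n ⊗[ℚ] Ln n

/-- The variable `x_i`. -/
def Xv {n : ℕ} (i : Fin n) : An n := MvPolynomial.X (i, 0)

/-- The variable `y_i`. -/
def Yv {n : ℕ} (i : Fin n) : An n := MvPolynomial.X (i, 1)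

/-- The Grassmann variable `θ_i` inside `Λ(θ)`. -/
def th {n : ℕ} (i : Fin n) : Ln n := ExteriorAlgebra.ι ℚ (Pi.single i 1)

/-- The Grassmann variable `θ_i` as an element of `R_n`. -/
def thR {n : ℕ} (i : Fin n) : Rn n := (1 : An n) ⊗ₜ[ℚ] th i

/-- The polarized power sum `p_{r,s} = Σ_i x_i^r y_i^s` in `A_n`. -/
def pA (n r s : ℕ) : An n := ∑ i : Fin n, Xv i ^ r * Yv i ^ s

/-- The polarized power sum `p_{r,s}` as an element of `R_n`. -/
def pR (n r s : ℕ) : Rn n := pA n r s ⊗ₜ[ℚ] 1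

/-- The super power sum `p̃_{r,s} = Σ_i x_i^r y_i^s θ_i` in `R_n`. -/
def ptR (n r s : ℕ) : Rn n := ∑ i : Fin n, (Xv i ^ r * Yv i ^ s) ⊗ₜ[ℚ] th i

/-- The set of generators of the ideal `I_n`. -/
def genSet (n : ℕ) : Set (Rn n) :=
  {z | ∃ r s : ℕ, 0 < r + s ∧ r + s ≤ n ∧ z = pR n r s} ∪
    {z | ∃ r s : ℕ, r + s < n ∧ z = ptR n r s}

/-- The two-sided ideal `I_n` of `R_n`. -/
def In (n : ℕ) : TwoSidedIdeal (Rn n) := TwoSidedIdeal.span (genSet n)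

/-- The ideal `I_n` viewed as a `ℚ`-submodule of `R_n`. -/
def Isub (n : ℕ) : Submodule ℚ (Rn n) := Submodule.span ℚ ((In n : Set (Rn n)))

/-- The super-diagonal coinvariant module `M_n = R_n / I_n`. -/
abbrev Mn (n : ℕ) := Rn n ⧸ Isub n

/-- The action of a permutation `σ` on `A_n`, permuting indices of the `x` and `y`
variables simultaneously: `x_i ↦ x_{σ i}`, `y_i ↦ y_{σ i}`. -/
def permA {n : ℕ} (σ : Equiv.Perm (Fin n)) : An n ≃ₐ[ℚ] An n :=
  MvPolynomial.renameEquiv ℚ (σ.prodCongr (Equiv.refl (Fin 2)))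

/-- The linear action of a permutation on `Fin n → ℚ`, sending
`Pi.single i 1 ↦ Pi.single (σ i) 1`. -/
def permV {n : ℕ} (σ : Equiv.Perm (Fin n)) : (Fin n → ℚ) ≃ₗ[ℚ] (Fin n → ℚ) :=
  LinearEquiv.funCongrLeft ℚ ℚ (σ⁻¹ : Equiv.Perm (Fin n))

/-- The action of a permutation `σ` on the Grassmann algebra, with `θ_i ↦ θ_{σ i}`. -/
def permL {n : ℕ} (σ : Equiv.Perm (Fin n)) : Ln n ≃ₐ[ℚ] Ln n :=
  AlgEquiv.ofAlgHom (ExteriorAlgebra.map (permV σ).toLinearMap)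
    (ExteriorAlgebra.map (permV σ).symm.toLinearMap)
    (by rw [ExteriorAlgebra.map_comp_map]
        convert ExteriorAlgebra.map_id using 2
        ext x; simp)
    (by rw [ExteriorAlgebra.map_comp_map]
        convert ExteriorAlgebra.map_id using 2
        ext x; simp)

/-- The diagonal action of a permutation `σ` on `R_n`, simultaneously permuting the
indices of the three sets of variables: `x_i ↦ x_{σ i}`, `y_i ↦ y_{σ i}`, `θ_i ↦ θ_{σ i}`. -/
def actR {n : ℕ} (σ : Equiv.Perm (Fin n)) : Rn n ≃ₐ[ℚ] Rn n :=
  Algebra.TensorProduct.congr (permA σ) (permL σ)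

/-- The weight function recording the `x`-degree and `y`-degree of each variable. -/
def wxy (n : ℕ) : Fin n × Fin 2 → ℕ × ℕ := fun q => if q.2 = 0 then (1, 0) else (0, 1)

/-- The space of polynomials in `A_n` homogeneous of degree `a` in the `x`-variables
and degree `b` in the `y`-variables. -/
def bidegA (n a b : ℕ) : Submodule ℚ (An n) :=
  MvPolynomial.weightedHomogeneousSubmodule ℚ (wxy n) (a, b)

/-- The space of elements of the Grassmann algebra homogeneous of degree `c` in the
`θ`-variables. -/
def thetaDeg (n c : ℕ) : Submodule ℚ (Ln n) := ⋀[ℚ]^c (Fin n → ℚ)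

/-- The tri-homogeneous component `R_n^{(a,b,c)}` of `R_n`, of degree `a` in the
`x`-variables, `b` in the `y`-variables and `c` in the `θ`-variables. -/
def comp3 (n a b c : ℕ) : Submodule ℚ (Rn n) :=
  LinearMap.range (TensorProduct.map (bidegA n a b).subtype (thetaDeg n c).subtype)

/-- The homogeneous component of `R_n` of degree `c` in the `θ`-variables. -/
def thetaComp (n c : ℕ) : Submodule ℚ (Rn n) :=
  LinearMap.range
    (TensorProduct.map (⊤ : Submodule ℚ (An n)).subtype (thetaDeg n c).subtype)

end

noncomputable section

/-- One-index monomials `x_i^r y_i^s θ_i^c`. -/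
def elm {n : ℕ} (u : ℕ × ℕ × ℕ) (i : Fin n) : Rn n :=
  (Xv i ^ u.1 * Yv i ^ u.2.1) ⊗ₜ[ℚ] (th i ^ u.2.2)

lemma elm_mul_same {n : ℕ} (u v : ℕ × ℕ × ℕ) (i : Fin n) :
    elm u i * elm v i = elm (u + v) i := by
  simp only [elm, Algebra.TensorProduct.tmul_mul_tmul, Prod.fst_add, Prod.snd_add, pow_add]
  congr 1
  ring

lemma th_swap {n : ℕ} (i j : Fin n) : th i * th j = (-1 : ℚ) • (th j * th i) := by
  have := ExteriorAlgebra.ι_add_mul_swap (R := ℚ) (Pi.single i 1 : Fin n → ℚ) (Pi.single j 1)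
  rw [neg_smul, one_smul]
  exact eq_neg_of_add_eq_zero_left this

lemma th_pow_swap1 {n : ℕ} (i j : Fin n) (d : ℕ) :
    ∃ q : ℚ, th i * th j ^ d = q • (th j ^ d * th i) := by
  induction d with
  | zero => exact ⟨1, by simp⟩
  | succ d ih =>
    obtain ⟨q, hq⟩ := ih
    refine ⟨q * (-1), ?_⟩
    rw [pow_succ, ← mul_assoc, hq, smul_mul_assoc, mul_assoc, th_swap, mul_smul_comm, smul_smul,
      mul_assoc]

lemma th_pow_swap {n : ℕ} (i j : Fin n) (c d : ℕ) :
    ∃ q : ℚ, th i ^ c * th j ^ d = q • (th j ^ d * th i ^ c) := by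
  induction c with
  | zero => exact ⟨1, by simp⟩
  | succ c ih =>
    obtain ⟨q, hq⟩ := ih
    obtain ⟨q', hq'⟩ := th_pow_swap1 i j d
    refine ⟨q' * q, ?_⟩
    rw [pow_succ, mul_assoc, hq', mul_smul_comm, ← mul_assoc, hq, smul_mul_assoc, smul_smul,
      mul_assoc]

lemma elm_swap {n : ℕ} (u v : ℕ × ℕ × ℕ) (i j : Fin n) :
    ∃ q : ℚ, elm u i * elm v j = q • (elm v j * elm u i) := by
  obtain ⟨q, hq⟩ := th_pow_swap i j u.2.2 v.2.2
  refine ⟨q, ?_⟩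
  simp only [elm, Algebra.TensorProduct.tmul_mul_tmul, hq, TensorProduct.tmul_smul]
  rw [mul_comm]

/-- Product of a list of one-index monomials. -/
def lprod {n : ℕ} (L : List ((ℕ × ℕ × ℕ) × Fin n)) : Rn n :=
  (L.map fun a => elm a.1 a.2).prod

lemma lprod_cons {n : ℕ} (a : (ℕ × ℕ × ℕ) × Fin n) (L : List ((ℕ × ℕ × ℕ) × Fin n)) :
    lprod (a :: L) = elm a.1 a.2 * lprod L := by
  simp [lprod]

lemma merge {n : ℕ} (u : ℕ × ℕ × ℕ) (l : Fin n) (L : List ((ℕ × ℕ × ℕ) × Fin n))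
    (h : l ∈ L.map Prod.snd) :
    ∃ (q : ℚ) (L' : List ((ℕ × ℕ × ℕ) × Fin n)), L'.length = L.length ∧
      elm u l * lprod L = q • lprod L' := by
  induction L with
  | nil => simp at h
  | cons a L ih =>
    by_cases hl : l = a.2
    · refine ⟨1, (u + a.1, l) :: L, by simp, ?_⟩
      rw [lprod_cons, lprod_cons, ← mul_assoc, ← hl, elm_mul_same, one_smul]
    · have h' : l ∈ L.map Prod.snd := by
        rw [List.map_cons, List.mem_cons] at h
        exact h.resolve_left hl
      obtain ⟨q, L', hlen, he⟩ := ih h'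
      obtain ⟨q', hq'⟩ := elm_swap u a.1 l a.2
      refine ⟨q' * q, a :: L', by simp [hlen], ?_⟩
      rw [lprod_cons, lprod_cons, ← mul_assoc, hq', smul_mul_assoc, mul_assoc, he,
        mul_smul_comm, smul_smul]

lemma permV_single {n : ℕ} (σ : Equiv.Perm (Fin n)) (i : Fin n) :
    permV σ (Pi.single i 1) = Pi.single (σ i) 1 := by
  ext j
  simp only [permV, LinearEquiv.funCongrLeft_apply, LinearMap.funLeft_apply, Pi.single_apply]
  congr 1
  rw [Equiv.Perm.inv_eq_iff_eq, eq_comm, eq_comm (a := j)]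

lemma permL_th {n : ℕ} (σ : Equiv.Perm (Fin n)) (i : Fin n) : permL σ (th i) = th (σ i) := by
  simp only [permL, th, AlgEquiv.ofAlgHom_apply, ExteriorAlgebra.map_apply_ι,
    LinearEquiv.coe_coe, permV_single]

lemma actR_elm {n : ℕ} (σ : Equiv.Perm (Fin n)) (u : ℕ × ℕ × ℕ) (i : Fin n) :
    actR σ (elm u i) = elm u (σ i) := by
  simp [actR, elm, Algebra.TensorProduct.congr_apply, permL_th, permA, Xv, Yv]

lemma actR_lprod {n : ℕ} (σ : Equiv.Perm (Fin n)) (L : List ((ℕ × ℕ × ℕ) × Fin n)) :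
    actR σ (lprod L) = lprod (L.map fun a => (a.1, σ a.2)) := by
  simp [lprod, map_list_prod, Function.comp_def, actR_elm]

/-- All power sums. -/
def psm (n : ℕ) (u : ℕ × ℕ × ℕ) : Rn n := ∑ i : Fin n, elm u i

/-- The symmetrization. -/
def symz {n : ℕ} : Rn n →ₗ[ℚ] Rn n := ∑ σ : Equiv.Perm (Fin n), (actR σ).toLinearMap

lemma symz_apply {n : ℕ} (x : Rn n) : symz x = ∑ σ : Equiv.Perm (Fin n), actR σ x := by
  simp [symz]

lemma actR_psm {n : ℕ} (σ : Equiv.Perm (Fin n)) (u : ℕ × ℕ × ℕ) :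
    actR σ (psm n u) = psm n u := by
  simp only [psm, map_sum, actR_elm]
  exact Equiv.sum_comp σ (fun i => elm u i)

lemma symz_psm_mul {n : ℕ} (u : ℕ × ℕ × ℕ) (x : Rn n) :
    symz (psm n u * x) = psm n u * symz x := by
  simp only [symz_apply, map_mul, actR_psm, Finset.mul_sum]

lemma symz_actR {n : ℕ} (τ : Equiv.Perm (Fin n)) (x : Rn n) : symz (actR τ x) = symz x := by
  have key : ∀ σ : Equiv.Perm (Fin n), actR σ (actR τ x) = actR (σ * τ) x := by
    intro σ
    have : ((actR σ).toAlgHom.comp (actR τ).toAlgHom) = (actR (σ * τ)).toAlgHom := by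
      apply Algebra.TensorProduct.ext
      · apply MvPolynomial.algHom_ext
        rintro ⟨i, j⟩
        simp [actR, permA]
      · apply ExteriorAlgebra.hom_ext
        apply LinearMap.pi_ext'
        intro i
        apply LinearMap.ext_ring
        have := permL_th (σ := σ) (τ i)
        have h2 := permL_th (σ := τ) i
        have h3 := permL_th (σ := σ * τ) i
        simp only [th] at this h2 h3
        simp [actR, h2, this, h3]
    exact DFunLike.congr_fun this x
  simp only [symz_apply, key]
  exact Equiv.sum_comp (Equiv.mulRight τ) (fun σ => actR σ x)

lemma symz_lprod_mem {n : ℕ} (G : Subalgebra ℚ (Rn n)) (hG : ∀ u, psm n u ∈ G) (k : ℕ) :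
    ∀ L : List ((ℕ × ℕ × ℕ) × Fin n), L.length = k → symz (lprod L) ∈ G := by
  induction k with
  | zero =>
    intro L hL
    obtain rfl := List.length_eq_zero_iff.mp hL
    simp only [symz_apply, lprod, List.map_nil, List.prod_nil, map_one]
    exact Subalgebra.sum_mem _ fun _ _ => G.one_mem
  | succ k ih =>
    rintro (_ | ⟨⟨u, i⟩, L⟩) hL
    · simp at hL
    have hL' : L.length = k := by simpa using hL
    rw [lprod_cons]
    have hold : ∀ l ∈ L.map Prod.snd, symz (elm u l * lprod L) ∈ G := by
      intro l hl
      obtain ⟨q, L', hlen, he⟩ := merge u l L hl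
      rw [he, map_smul]
      exact G.smul_mem (ih L' (hlen.trans hL')) q
    by_cases hi : i ∈ L.map Prod.snd
    · exact hold i hi
    have hnew : ∀ l, l ∉ L.map Prod.snd →
        symz (elm u l * lprod L) = symz (elm u i * lprod L) := by
      intro l hl
      rw [← symz_actR (Equiv.swap i l) (elm u i * lprod L), map_mul (actR _), actR_elm, actR_lprod,
        Equiv.swap_apply_left]
      congr 3
      conv_lhs => rw [← List.map_id L]
      apply List.map_congr_left
      intro a ha
      have ha' : a.2 ∈ L.map Prod.snd := List.mem_map_of_mem ha
      rw [Equiv.swap_apply_of_ne_of_ne]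
      · rfl
      · rintro rfl; exact hi ha'
      · rintro rfl; exact hl ha'
    have htot : psm n u * symz (lprod L) = ∑ l, symz (elm u l * lprod L) := by
      rw [← symz_psm_mul, psm, Finset.sum_mul, map_sum]
    rw [← Finset.sum_filter_add_sum_filter_not Finset.univ (fun l => l ∈ L.map Prod.snd)] at htot
    rw [Finset.sum_congr rfl (fun l hl => hnew l (Finset.mem_filter.mp hl).2) (s₁ := Finset.filter (fun l => ¬ l ∈ L.map Prod.snd) Finset.univ),
      Finset.sum_const] at htot
    set N := (Finset.filter (fun l => ¬ l ∈ L.map Prod.snd) Finset.univ).card with hN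
    have hNpos : (N : ℚ) ≠ 0 := by
      have : 0 < N := Finset.card_pos.mpr ⟨i, by simpa using hi⟩
      exact_mod_cast this.ne'
    have hmem : (N : ℚ) • symz (elm u i * lprod L) ∈ G := by
      rw [Nat.cast_smul_eq_nsmul, eq_sub_iff_add_eq'.mpr htot.symm]
      refine G.sub_mem (G.mul_mem (hG u) (ih L hL')) (G.sum_mem fun l hl => hold l ?_)
      exact (Finset.mem_filter.mp hl).2
    have := G.smul_mem hmem (N : ℚ)⁻¹
    rwa [smul_smul, inv_mul_cancel₀ hNpos, one_smul] at this

lemma adjoin_elm (n : ℕ) :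
    Algebra.adjoin ℚ (Set.range fun a : (ℕ × ℕ × ℕ) × Fin n => elm a.1 a.2) = ⊤ := by
  set T := Algebra.adjoin ℚ (Set.range fun a : (ℕ × ℕ × ℕ) × Fin n => elm a.1 a.2) with hT
  have he : ∀ u (i : Fin n), elm u i ∈ T := fun u i => Algebra.subset_adjoin ⟨(u, i), rfl⟩
  have h1 : ∀ a : An n, (Algebra.TensorProduct.includeLeft : An n →ₐ[ℚ] Rn n) a ∈ T := by
    intro a
    induction a using MvPolynomial.induction_on with
    | C q => 
      have := T.algebraMap_mem q
      rwa [← AlgHom.commutes (Algebra.TensorProduct.includeLeft : An n →ₐ[ℚ] Rn n)] at this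
    | add p q hp hq => rw [map_add]; exact T.add_mem hp hq
    | mul_X p i hp =>
      rw [map_mul]
      refine T.mul_mem hp ?_
      obtain ⟨i, j⟩ := i
      fin_cases j
      · simpa [elm, Xv] using he (1, 0, 0) i
      · simpa [elm, Yv] using he (0, 1, 0) i
  have h2 : ∀ b : Ln n, (Algebra.TensorProduct.includeRight : Ln n →ₐ[ℚ] Rn n) b ∈ T := by
    intro b
    induction b using ExteriorAlgebra.induction with
    | algebraMap q => rw [AlgHom.commutes]; exact T.algebraMap_mem q
    | ι v =>
      have : v = ∑ i, v i • (Pi.single i 1 : Fin n → ℚ) := by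
        ext j
        simp [Finset.sum_apply, Pi.single_apply]
      rw [this, map_sum, map_sum]
      refine T.sum_mem fun i _ => ?_
      rw [map_smul, map_smul]
      refine T.smul_mem ?_ _
      simpa [elm, th] using he (0, 0, 1) i
    | mul a b ha hb => rw [map_mul]; exact T.mul_mem ha hb
    | add a b ha hb => rw [map_add]; exact T.add_mem ha hb
  rw [eq_top_iff]
  rintro x -
  induction x using TensorProduct.induction_on with
  | zero => exact T.zero_mem
  | add a b ha hb => exact T.add_mem ha hb
  | tmul a b =>
    have := T.mul_mem (h1 a) (h2 b)
    simpa using this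

lemma symz_mem {n : ℕ} (G : Subalgebra ℚ (Rn n)) (hG : ∀ u, psm n u ∈ G) (x : Rn n) :
    symz x ∈ G := by
  have hx : x ∈ Subalgebra.toSubmodule (Algebra.adjoin ℚ
      (Set.range fun a : (ℕ × ℕ × ℕ) × Fin n => elm a.1 a.2)) := by
    rw [adjoin_elm]; trivial
  rw [Algebra.adjoin_eq_span] at hx
  induction hx using Submodule.span_induction with
  | zero => rw [map_zero]; exact G.zero_mem
  | add a b _ _ ha hb => rw [map_add]; exact G.add_mem ha hb
  | smul q a _ ha => rw [map_smul]; exact G.smul_mem ha q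
  | mem x hx =>
    obtain ⟨l, hl, rfl⟩ := Submonoid.exists_list_of_mem_closure hx
    obtain ⟨L, rfl⟩ : ∃ L : List ((ℕ × ℕ × ℕ) × Fin n), L.map (fun a => elm a.1 a.2) = l := by
      have : l ∈ Set.range (List.map (fun a : (ℕ × ℕ × ℕ) × Fin n => elm a.1 a.2)) := by
        rw [Set.range_list_map]; exact hl
      exact this
    exact symz_lprod_mem G hG _ L rfl

open Polynomial in
/-- The generic linear form `x_i + t y_i`. -/
def zv {n : ℕ} (i : Fin n) : Polynomial (An n) := C (Xv i) + X * C (Yv i)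

lemma coeff_zv_pow {n : ℕ} (i : Fin n) (m s : ℕ) :
    (zv i ^ m).coeff s = (m.choose s : ℚ) • (Xv i ^ (m - s) * Yv i ^ s) := by
  rw [zv, add_comm, add_pow, Polynomial.finsetSum_coeff]
  have : ∀ k ∈ Finset.range (m + 1),
      ((Polynomial.X * Polynomial.C (Yv i)) ^ k * Polynomial.C (Xv i) ^ (m - k) *
        (m.choose k : Polynomial (An n))).coeff s =
      if s = k then (m.choose s : ℚ) • (Xv i ^ (m - s) * Yv i ^ s) else 0 := by
    intro k _
    have : ((Polynomial.X * Polynomial.C (Yv i)) ^ k * Polynomial.C (Xv i) ^ (m - k) *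
        (m.choose k : Polynomial (An n))) =
        Polynomial.C ((m.choose k : An n) * (Xv i ^ (m - k) * Yv i ^ k)) * Polynomial.X ^ k := by
      simp only [map_mul, map_pow, map_natCast]
      ring
    rw [this, Polynomial.coeff_C_mul_X_pow]
    split_ifs with h
    · subst h
      rw [Nat.cast_smul_eq_nsmul, nsmul_eq_mul]
    · rfl
  rw [Finset.sum_congr rfl this, Finset.sum_ite_eq]
  split_ifs with h
  · rfl
  · rw [Nat.choose_eq_zero_of_lt (by simpa using h)]; simp

/-- `(f_i) ↦ Σ f_i θ_i^c`. -/
def Tc {n : ℕ} (c : ℕ) (f : Fin n → An n) : Rn n := ∑ i, f i ⊗ₜ[ℚ] (th i ^ c)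

/-- Coefficients. -/
def Kn (n : ℕ) : Subalgebra ℚ (An n) :=
  (Algebra.adjoin ℚ (genSet n)).comap (Algebra.TensorProduct.includeLeft : An n →ₐ[ℚ] Rn n)

/-- Polynomials with coefficients in `Kn`. -/
def Hn (n : ℕ) : Subalgebra ℚ (Polynomial (An n)) := (Polynomial.mapAlgHom (Kn n).val).range

lemma mem_Hn {n : ℕ} (f : Polynomial (An n)) : f ∈ Hn n ↔ ∀ m, f.coeff m ∈ Kn n := by
  have := Polynomial.lifts_iff_coeff_lifts (f := (Kn n).val.toRingHom) f
  have h2 : f ∈ Hn n ↔ f ∈ Polynomial.lifts (Kn n).val.toRingHom := by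
    rw [Polynomial.mem_lifts]; rfl
  rw [h2, this]
  simp

lemma pA_mem (n r s : ℕ) (h : r + s ≤ n) : pA n r s ∈ Kn n := by
  by_cases h0 : 0 < r + s
  · exact Algebra.subset_adjoin (Or.inl ⟨r, s, h0, h, rfl⟩)
  · obtain ⟨rfl, rfl⟩ : r = 0 ∧ s = 0 := by omega
    simp only [pA, pow_zero, mul_one]
    exact Subalgebra.sum_mem _ fun _ _ => Subalgebra.one_mem _

lemma psum_mem (n j : ℕ) (h : j ≤ n) : ∑ i : Fin n, zv i ^ j ∈ Hn n := by
  rw [mem_Hn]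
  intro s
  simp only [Polynomial.finsetSum_coeff, coeff_zv_pow, ← Finset.smul_sum]
  by_cases hs : s ≤ j
  · exact Subalgebra.smul_mem _ (pA_mem n (j - s) s (by omega)) _
  · rw [Nat.choose_eq_zero_of_lt (by omega)]; simp [Subalgebra.zero_mem]

lemma esymm_mem (n k : ℕ) (h : k ≤ n) :
    MvPolynomial.aeval (fun i : Fin n => zv i) (MvPolynomial.esymm (Fin n) ℚ k) ∈ Hn n := by
  induction k using Nat.strong_induction_on with
  | _ k ih =>
  rcases Nat.eq_zero_or_pos k with rfl | hk
  · simp only [MvPolynomial.esymm_zero, map_one]; exact Subalgebra.one_mem _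
  have key := congrArg (MvPolynomial.aeval (fun i : Fin n => zv i))
    (MvPolynomial.mul_esymm_eq_sum (Fin n) ℚ k)
  have hm : (k : ℚ) • MvPolynomial.aeval (fun i : Fin n => zv i) (MvPolynomial.esymm (Fin n) ℚ k)
      ∈ Hn n := by
    rw [Nat.cast_smul_eq_nsmul, nsmul_eq_mul]
    rw [map_mul, map_natCast] at key
    rw [key]
    simp only [map_mul, map_sum, map_pow, map_neg, map_one]
    have hneg : (-1 : Polynomial (An n)) ∈ Hn n := Subalgebra.neg_mem _ (Subalgebra.one_mem _)
    refine Subalgebra.mul_mem _ (Subalgebra.pow_mem _ hneg _) (Subalgebra.sum_mem _ ?_)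
    intro a ha
    rw [Finset.mem_filter] at ha
    have ha1 := Finset.HasAntidiagonal.mem_antidiagonal.mp ha.1
    refine Subalgebra.mul_mem _ (Subalgebra.mul_mem _ (Subalgebra.pow_mem _ hneg _)
      (ih a.1 ha.2 (by omega))) ?_
    simp only [MvPolynomial.psum, map_sum, map_pow, MvPolynomial.aeval_X]
    exact psum_mem n a.2 (by omega)
  have := Subalgebra.smul_mem _ hm (k : ℚ)⁻¹
  rwa [smul_smul, inv_mul_cancel₀ (by exact_mod_cast hk.ne'), one_smul] at this

lemma rel_aux {R : Type*} [CommRing R] (z : R) (E : ℕ → R) (n m : ℕ) (hm : n ≤ m)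
    (key : 0 = ∑ k ∈ Finset.range n, (-1) ^ (k + 1) * (E (k + 1) * z ^ (n - (k + 1))) + z ^ n) :
    z ^ m = ∑ k ∈ Finset.range n, (-((-1) ^ (k + 1) * E (k + 1))) * z ^ (m - (k + 1)) := by
  have hz : z ^ m = z ^ n * z ^ (m - n) := by rw [← pow_add]; congr 1; omega
  rw [hz, ← neg_eq_of_add_eq_zero_right key.symm, neg_mul, Finset.sum_mul,
    ← Finset.sum_neg_distrib]
  refine Finset.sum_congr rfl fun k hk => ?_
  have hk' := Finset.mem_range.mp hk
  have : m - (k + 1) = (n - (k + 1)) + (m - n) := by omega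
  rw [this, pow_add]
  ring

lemma zv_rel (n : ℕ) : ∃ e : ℕ → Polynomial (An n), (∀ k, e k ∈ Hn n) ∧
    ∀ (i : Fin n) (m : ℕ), n ≤ m → zv i ^ m = ∑ k ∈ Finset.range n, e k * zv i ^ (m - (k + 1)) := by
  classical
  let E : ℕ → Polynomial (An n) := fun k =>
    MvPolynomial.aeval (fun i : Fin n => zv i) (MvPolynomial.esymm (Fin n) ℚ k)
  have hneg : (-1 : Polynomial (An n)) ∈ Hn n := Subalgebra.neg_mem _ (Subalgebra.one_mem _)
  refine ⟨fun k => if k < n then - ((-1) ^ (k + 1) * E (k + 1)) else 0, ?_, ?_⟩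
  · intro k
    dsimp only
    split_ifs with hk
    · exact (Hn n).neg_mem ((Hn n).mul_mem ((Hn n).pow_mem hneg _)
        (esymm_mem n (k + 1) hk))
    · exact Subalgebra.zero_mem _
  · intro i m hm
    have hE : ∀ k, E k = (Finset.univ.val.map (fun i : Fin n => zv i)).esymm k :=
      fun k => MvPolynomial.aeval_esymm_eq_multiset_esymm (Fin n) ℚ k _
    have key := congrArg (Polynomial.eval (zv i))
      (Multiset.prod_X_sub_X_eq_sum_esymm (Finset.univ.val.map (fun i : Fin n => zv i)))
    have hcard : Multiset.card (Finset.univ.val.map (fun i : Fin n => zv i)) = n := by simp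
    rw [hcard, Multiset.map_map] at key
    have hl : Polynomial.eval (zv i) (Multiset.map ((fun t => Polynomial.X - Polynomial.C t) ∘
        fun i : Fin n => zv i) Finset.univ.val).prod = 0 := by
      change Polynomial.eval (zv i) (∏ j : Fin n, (Polynomial.X - Polynomial.C (zv j))) = 0
      rw [Polynomial.eval_prod]
      exact Finset.prod_eq_zero (Finset.mem_univ i) (by simp)
    rw [hl] at key
    simp only [Polynomial.eval_finsetSum, Polynomial.eval_mul, Polynomial.eval_pow,
      Polynomial.eval_neg, Polynomial.eval_one, Polynomial.eval_C, Polynomial.eval_X, ← hE] at key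
    rw [Finset.sum_range_succ'] at key
    have hE0 : E 0 = 1 := by simp [E]
    simp only [hE0, pow_zero, one_mul, Nat.sub_zero] at key
    refine (rel_aux (zv i) E n m hm key).trans (Finset.sum_congr rfl fun k hk => ?_)
    dsimp only
    rw [if_pos (Finset.mem_range.mp hk)]

lemma Tc_mul {n : ℕ} (c : ℕ) (a : An n) (f : Fin n → An n) :
    Tc c (fun i => a * f i) = (a ⊗ₜ[ℚ] (1 : Ln n)) * Tc c f := by
  simp [Tc, Finset.mul_sum]

lemma Tc_sum {n : ℕ} {ι : Type*} (c : ℕ) (s : Finset ι) (f : ι → Fin n → An n) :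
    Tc c (fun i => ∑ k ∈ s, f k i) = ∑ k ∈ s, Tc c (f k) := by
  simp only [Tc, TensorProduct.sum_tmul]
  exact Finset.sum_comm

lemma Tc_smul {n : ℕ} (c : ℕ) (q : ℚ) (f : Fin n → An n) :
    Tc c (fun i => q • f i) = q • Tc c f := by
  simp [Tc, Finset.smul_sum, TensorProduct.smul_tmul']

lemma Tc_mem (n c : ℕ) (hc : c ≤ 1) (m : ℕ) : ∀ s : ℕ,
    Tc c (fun i : Fin n => (zv i ^ m).coeff s) ∈ Algebra.adjoin ℚ (genSet n) := by
  induction m using Nat.strong_induction_on with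
  | _ m ih =>
  intro s
  by_cases hm : m < n
  · simp only [coeff_zv_pow]
    rw [Tc_smul]
    by_cases hs : s ≤ m
    · refine Subalgebra.smul_mem _ ?_ _
      interval_cases c
      · have := pA_mem n (m - s) s (by omega)
        have h2 : Tc 0 (fun i : Fin n => Xv i ^ (m - s) * Yv i ^ s) =
            (Algebra.TensorProduct.includeLeft : An n →ₐ[ℚ] Rn n) (pA n (m - s) s) := by
          simp [Tc, pA, TensorProduct.sum_tmul]
        rw [h2]
        exact this
      · refine Algebra.subset_adjoin (Or.inr ⟨m - s, s, by omega, ?_⟩)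
        simp [Tc, ptR]
    · rw [Nat.choose_eq_zero_of_lt (by omega)]
      simp [Subalgebra.zero_mem]
  · obtain ⟨e, he, hrel⟩ := zv_rel n
    simp only [fun i => hrel i m (by omega), Polynomial.finsetSum_coeff, Polynomial.coeff_mul]
    rw [Tc_sum]
    refine Subalgebra.sum_mem _ fun k hk => ?_
    rw [Tc_sum]
    refine Subalgebra.sum_mem _ fun a _ => ?_
    rw [Tc_mul]
    have hk' := Finset.mem_range.mp hk
    exact Subalgebra.mul_mem _ ((mem_Hn _).mp (he k) a.1) (ih _ (by omega) _)

lemma psm_mem (n : ℕ) (u : ℕ × ℕ × ℕ) : psm n u ∈ Algebra.adjoin ℚ (genSet n) := by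
  obtain ⟨r, s, c⟩ := u
  by_cases hc : c ≤ 1
  · have h := Tc_mem n c hc (r + s) s
    simp only [coeff_zv_pow] at h
    rw [Tc_smul] at h
    have hne : ((r + s).choose s : ℚ) ≠ 0 := by
      exact_mod_cast (Nat.choose_pos (by omega)).ne'
    have := Subalgebra.smul_mem _ h ((r + s).choose s : ℚ)⁻¹
    rw [smul_smul, inv_mul_cancel₀ hne, one_smul] at this
    simpa [psm, elm, Tc] using this
  · have h0 : psm n (r, s, c) = 0 := by
      refine Finset.sum_eq_zero fun i _ => ?_
      obtain ⟨d, rfl⟩ : ∃ d, c = 2 + d := ⟨c - 2, by omega⟩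
      have : th i ^ 2 = 0 := by rw [pow_two]; exact ExteriorAlgebra.ι_sq_zero _
      simp [elm, pow_add, this]
    rw [h0]
    exact Subalgebra.zero_mem _

/-- For every `n ≥ 1`, the subring of `S_n`-invariant elements of `R_n` is generated
as a `ℚ`-algebra by the elements `p_{r,s}` for `0 < r + s ≤ n` together with the
elements `p̃_{r',s'}` for `0 ≤ r' + s' < n`. -/
theorem invariants_generated_by_power_sums (n : ℕ) (hn : 1 ≤ n) :
    ∀ x : Rn n,
      x ∈ Algebra.adjoin ℚ (genSet n) ↔ ∀ σ : Equiv.Perm (Fin n), actR σ x = x := by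
  intro x
  constructor
  · intro hx σ
    have hle : Algebra.adjoin ℚ (genSet n) ≤
        AlgHom.equalizer (actR σ).toAlgHom (AlgHom.id ℚ (Rn n)) := by
      apply Algebra.adjoin_le
      rintro z (⟨r, s, -, -, rfl⟩ | ⟨r, s, -, rfl⟩)
      · have : pR n r s = psm n (r, s, 0) := by
          simp [pR, pA, psm, elm, TensorProduct.sum_tmul]
        rw [this]
        exact actR_psm σ _
      · have : ptR n r s = psm n (r, s, 1) := by
          simp [ptR, psm, elm]
        rw [this]
        exact actR_psm σ _
    exact hle hx
  · intro hx
    have h := symz_mem _ (psm_mem n) x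
    rw [symz_apply, Finset.sum_congr rfl (fun σ _ => hx σ), Finset.sum_const,
      ← Nat.cast_smul_eq_nsmul ℚ] at h
    have hne : ((Finset.univ : Finset (Equiv.Perm (Fin n))).card : ℚ) ≠ 0 := by
      exact_mod_cast (Finset.card_pos.mpr ⟨1, Finset.mem_univ _⟩).ne'
    have := Subalgebra.smul_mem _ h ((Finset.univ : Finset (Equiv.Perm (Fin n))).card : ℚ)⁻¹
    rwa [smul_smul, inv_mul_cancel₀ hne, one_smul] at this

end
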